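/- There exist δ > 0 and C > 0 such that for every q ∈ ℕ and every a ∈ A_q, the Gaussian sum G(a/q) = q^{−k} Σ_{y∈{1,…,q}^k} e^{2πi⟨a/q, 𝒬(y)⟩} satisfies |G(a/q)| ≤ C q^{−δ}. -/

import Mathlib

open MeasureTheory
open scoped BigOperators

noncomputable section

/-- `expc t = exp(2 π i t)`. -/
def expc (t : ℝ) : ℂ := Complex.exp ((2 * Real.pi * t : ℝ) * Complex.I)

/-- Euclidean norm of a vector in `ℝ^ι`. -/
def enorm {ι : Type*} [Fintype ι] (x : ι → ℝ) : ℝ := Real.sqrt (∑ i, x i ^ 2)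

/-- Euclidean norm of the gradient of a real valued function on `ℝ^ι`. -/
def gradNorm {ι : Type*} [Fintype ι] [DecidableEq ι] (K : (ι → ℝ) → ℝ) (x : ι → ℝ) : ℝ :=
  Real.sqrt (∑ i, (fderiv ℝ K x (Pi.single i 1)) ^ 2)

/-- Fourier series `f̂` of a function on `ℤ^ι`, as a function on `ℝ^ι` (periodic). -/
def fhat {ι : Type*} [Fintype ι] (f : (ι → ℤ) → ℂ) (ξ : ι → ℝ) : ℂ :=
  ∑' x : ι → ℤ, f x * expc (∑ i, ξ i * (x i : ℝ))

/-- Inverse Fourier transform (Fourier coefficients) of a periodic function on the torus. -/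
def invF {ι : Type*} [Fintype ι] (g : (ι → ℝ) → ℂ) (x : ι → ℤ) : ℂ :=
  ∫ ξ in Set.univ.pi (fun _ : ι => Set.Ico (0:ℝ) 1), g ξ * expc (-(∑ i, ξ i * (x i : ℝ)))

/-- `ℓ^p` norm of a complex valued function on `ℤ^ι`. -/
def lpNormZ {ι : Type*} [Fintype ι] (p : ℝ) (f : (ι → ℤ) → ℂ) : ℝ :=
  (∑' x : ι → ℤ, ‖f x‖ ^ p) ^ (1/p)

/-- `ℓ^p` norm of a real valued function on `ℤ^ι`. -/
def lpNormZr {ι : Type*} [Fintype ι] (p : ℝ) (f : (ι → ℤ) → ℝ) : ℝ :=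
  (∑' x : ι → ℤ, |f x| ^ p) ^ (1/p)

/-- The set `Γ` of multi-indices `γ ≠ 0` with `0 ≤ γ_j ≤ N₀`, realized as a type. -/
abbrev GammaSet (k N₀ : ℕ) := {γ : Fin k → Fin (N₀ + 1) // γ ≠ fun _ => 0}

/-- `|γ| = γ_1 + … + γ_k`. -/
def degG {k N₀ : ℕ} (γ : GammaSet k N₀) : ℕ := ∑ j, (γ.1 j : ℕ)

/-- `⟨ξ, 𝒬(y)⟩ = ∑_{γ ∈ Γ} ξ_γ y^γ`, where `𝒬` is the canonical polynomial mapping. -/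
def dotQ {k N₀ : ℕ} (ξ : GammaSet k N₀ → ℝ) (y : Fin k → ℝ) : ℝ :=
  ∑ γ : GammaSet k N₀, ξ γ * ∏ j, y j ^ (γ.1 j : ℕ)

/-- The exponential sum `m_n(ξ) = ∑_{y ∈ ℤ^k} e^{2πi⟨ξ,𝒬(y)⟩} K_n(y)`. -/
def mExp {k N₀ : ℕ} (Kn : (Fin k → ℝ) → ℝ) (ξ : GammaSet k N₀ → ℝ) : ℂ :=
  ∑' y : Fin k → ℤ, expc (dotQ ξ (fun j => (y j : ℝ))) * (Kn (fun j => (y j : ℝ)) : ℂ)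

/-- The oscillatory integral `Φ_n(ξ) = ∫_{ℝ^k} e^{2πi⟨ξ,𝒬(y)⟩} K_n(y) dy`. -/
def PhiInt {k N₀ : ℕ} (Kn : (Fin k → ℝ) → ℝ) (ξ : GammaSet k N₀ → ℝ) : ℂ :=
  ∫ y : Fin k → ℝ, expc (dotQ ξ y) * (Kn y : ℂ)

/-- The Gaussian sum `G(a/q) = q^{-k} ∑_{y ∈ ℕ_q^k} e^{2πi⟨a/q, 𝒬(y)⟩}`. -/
def gaussSumQ (k N₀ : ℕ) (q : ℕ) (a : GammaSet k N₀ → ℕ) : ℂ :=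
  ((q : ℂ) ^ k)⁻¹ *
    ∑ y ∈ Fintype.piFinset (fun _ : Fin k => Finset.Icc 1 q),
      expc (dotQ (fun γ => (a γ : ℝ) / q) (fun j => (y j : ℝ)))
/-- `A_q`: numerators `a ∈ {1,…,q}^Γ` with `gcd(q, gcd(a_γ : γ ∈ Γ)) = 1`. -/
def AqG (k N₀ q : ℕ) : Finset (GammaSet k N₀ → ℕ) :=
  (Fintype.piFinset fun _ : GammaSet k N₀ => Finset.Icc 1 q).filter
    fun a => Nat.gcd q (Finset.univ.gcd a) = 1


open Polynomial ZMod

/-- The absolute value of the normalized complete exponential sum of a polynomial modulo `q`. -/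
def weylMean {q : ℕ} [NeZero q] (P : (ZMod q)[X]) : ℝ :=
  ‖∑ t : ZMod q, stdAddChar (P.eval t)‖ / q

/-- The least `n > 0` such that `n • P` is a constant polynomial. -/
def nonconstOrder {q : ℕ} (P : (ZMod q)[X]) : ℕ := addOrderOf (P - C (P.coeff 0))

section

variable {q : ℕ}

lemma nonconstOrder_dvd_iff (P : (ZMod q)[X]) (n : ℕ) :
    nonconstOrder P ∣ n ↔ ∀ i, i ≠ 0 → n • P.coeff i = 0 := by
  rw [nonconstOrder, addOrderOf_dvd_iff_nsmul_eq_zero, Polynomial.ext_iff]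
  refine forall_congr' fun i => ?_
  by_cases hi : i = 0
  · subst hi; simp
  · simp [hi, coeff_C]

lemma nonconstOrder_dvd_iff_exists (P : (ZMod q)[X]) (n : ℕ) :
    nonconstOrder P ∣ n ↔ ∃ c, n • P = C c := by
  rw [nonconstOrder_dvd_iff]
  constructor
  · intro h
    refine ⟨n • P.coeff 0, ?_⟩
    ext i
    by_cases hi : i = 0
    · subst hi; simp
    · rw [coeff_smul, h i hi, coeff_C, if_neg hi]
  · rintro ⟨c, hc⟩ i hi
    rw [← coeff_smul, hc, coeff_C, if_neg hi]

lemma coeff_taylor_sub (P : (ZMod q)[X]) {d : ℕ} (hP : P.natDegree ≤ d + 1) (h : ZMod q) :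
    (taylor h P - P).coeff d = ((d + 1) • P.coeff (d + 1)) * h := by
  have hdeg : (hasseDeriv d P).natDegree < 2 := by
    have := natDegree_hasseDeriv_le P d; omega
  rw [coeff_sub, taylor_coeff, eval_eq_sum_range' hdeg]
  simp [Finset.sum_range_succ, hasseDeriv_coeff, add_comm 1 d]

lemma natDegree_taylor_sub_le (P : (ZMod q)[X]) {d : ℕ} (hP : P.natDegree ≤ d + 1) (h : ZMod q) :
    (taylor h P - P).natDegree ≤ d := by
  rw [natDegree_le_iff_coeff_eq_zero]
  intro N hN
  have hdeg : (hasseDeriv N P).natDegree < 1 := by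
    have := natDegree_hasseDeriv_le P N; omega
  rw [coeff_sub, taylor_coeff, eval_eq_sum_range' hdeg]
  simp [hasseDeriv_coeff]

variable [NeZero q]

lemma weylMean_nonneg (P : (ZMod q)[X]) : 0 ≤ weylMean P := by
  unfold weylMean; positivity

lemma natCast_pos_of_neZero (q : ℕ) [NeZero q] : (0 : ℝ) < q :=
  Nat.cast_pos.2 (NeZero.pos q)

lemma weylMean_le_one (P : (ZMod q)[X]) : weylMean P ≤ 1 := by
  unfold weylMean
  rw [div_le_one (natCast_pos_of_neZero q)]
  refine (norm_sum_le _ _).trans ?_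
  simp [ZMod.card]

lemma nonconstOrder_pos (P : (ZMod q)[X]) : 0 < nonconstOrder P := by
  refine Nat.pos_of_dvd_of_pos ((nonconstOrder_dvd_iff P q).2 fun i _ => ?_) (NeZero.pos q)
  simp

lemma addOrderOf_coeff_le_nonconstOrder (P : (ZMod q)[X]) {i : ℕ} (hi : i ≠ 0) :
    addOrderOf (P.coeff i) ≤ nonconstOrder P :=
  Nat.le_of_dvd (nonconstOrder_pos P) <| addOrderOf_dvd_iff_nsmul_eq_zero.2 <|
    (nonconstOrder_dvd_iff P _).1 dvd_rfl i hi

lemma addOrderOf_le_mul_addOrderOf_nsmul (x : ZMod q) {s : ℕ} (hs : 0 < s) :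
    addOrderOf x ≤ s * addOrderOf (s • x) := by
  refine Nat.le_of_dvd (Nat.mul_pos hs (addOrderOf_pos _)) ?_
  rw [addOrderOf_dvd_iff_nsmul_eq_zero, mul_comm, mul_nsmul', addOrderOf_nsmul_eq_zero]

lemma card_mul_eq_zero_mul_addOrderOf_le (y : ZMod q) :
    (Finset.univ.filter fun h : ZMod q => y * h = 0).card * addOrderOf y ≤ q := by
  set f := AddMonoidHom.mulLeft y
  have h1 := f.ker.card_mul_index
  rw [AddSubgroup.index_ker, Nat.card_zmod] at h1
  have h2 : Nat.card f.ker = (Finset.univ.filter fun h : ZMod q => y * h = 0).card := by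
    rw [Nat.card_eq_fintype_card, Fintype.card_subtype]
    simp [f, AddMonoidHom.mem_ker]
  have h3 : addOrderOf y ≤ Nat.card f.range := by
    rw [← Nat.card_zmultiples]
    refine Nat.card_le_card_of_injective _ (AddSubgroup.inclusion_injective ?_)
    rw [AddSubgroup.zmultiples_le]
    exact ⟨1, by simp [f]⟩
  calc _ ≤ _ := Nat.mul_le_mul h2.ge h3
    _ = q := h1

lemma card_addOrderOf_mul_eq_le (x : ZMod q) {s : ℕ} (hs : 0 < s) :
    ((Finset.univ.filter fun h : ZMod q => addOrderOf (x * h) = s).card : ℝ)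
      ≤ s * (q / addOrderOf x) := by
  have hm : (0 : ℝ) < addOrderOf x := Nat.cast_pos.2 (addOrderOf_pos x)
  rw [← mul_div_assoc, le_div_iff₀ hm]
  norm_cast
  have h1 : (Finset.univ.filter fun h : ZMod q => addOrderOf (x * h) = s).card ≤
      (Finset.univ.filter fun h : ZMod q => (s • x) * h = 0).card := by
    refine Finset.card_le_card fun h => ?_
    simp only [Finset.mem_filter, Finset.mem_univ, true_and]
    rintro rfl
    rw [smul_mul_assoc, addOrderOf_nsmul_eq_zero]
  calc _ ≤ _ := Nat.mul_le_mul h1 (addOrderOf_le_mul_addOrderOf_nsmul x hs)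
    _ = s * ((Finset.univ.filter fun h : ZMod q => (s • x) * h = 0).card * addOrderOf (s • x)) := by
      ring
    _ ≤ _ := Nat.mul_le_mul_left _ (card_mul_eq_zero_mul_addOrderOf_le _)

lemma sum_inv_addOrderOf_mul_cubed_le (x : ZMod q) :
    ∑ h : ZMod q, ((addOrderOf (x * h) : ℝ) ^ 3)⁻¹ ≤ 2 * (q / addOrderOf x) := by
  have hq := natCast_pos_of_neZero q
  have hm : (0 : ℝ) < addOrderOf x := Nat.cast_pos.2 (addOrderOf_pos x)
  have hmaps : ∀ h ∈ (Finset.univ : Finset (ZMod q)),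
      addOrderOf (x * h) ∈ Finset.Ioo 0 (q + 1) := by
    intro h _
    rw [Finset.mem_Ioo]
    refine ⟨addOrderOf_pos _, Nat.lt_succ_of_le ?_⟩
    simpa using addOrderOf_le_card_univ (x := x * h)
  rw [← Finset.sum_fiberwise_of_maps_to hmaps]
  calc _ ≤ ∑ s ∈ Finset.Ioo 0 (q + 1), ((s : ℝ) ^ 2)⁻¹ * (q / addOrderOf x) := by
        refine Finset.sum_le_sum fun s hs => ?_
        have hs0 : 0 < s := (Finset.mem_Ioo.1 hs).1
        have hs' : (0 : ℝ) < s := Nat.cast_pos.2 hs0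
        rw [Finset.sum_congr rfl (g := fun _ => ((s : ℝ) ^ 3)⁻¹)
          (fun h hh => by rw [(Finset.mem_filter.1 hh).2]), Finset.sum_const, nsmul_eq_mul]
        calc _ ≤ (s * (q / addOrderOf x) : ℝ) * ((s : ℝ) ^ 3)⁻¹ := by
              gcongr; exact card_addOrderOf_mul_eq_le x hs0
          _ = _ := by field_simp
    _ = (∑ s ∈ Finset.Ioo 0 (q + 1), ((s : ℝ) ^ 2)⁻¹) * (q / addOrderOf x) := by
        rw [Finset.sum_mul]
    _ ≤ _ := by
        gcongr
        simpa using sum_Ioo_inv_sq_le (α := ℝ) 0 (q + 1)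

lemma weylMean_sq_le (P : (ZMod q)[X]) :
    weylMean P ^ 2 ≤ (∑ h : ZMod q, weylMean (taylor h P - P)) / q := by
  have hq := natCast_pos_of_neZero q
  have key : ((‖∑ t : ZMod q, stdAddChar (P.eval t)‖ ^ 2 : ℝ) : ℂ) =
      ∑ h : ZMod q, ∑ t : ZMod q, stdAddChar ((taylor h P - P).eval t) := by
    push_cast
    rw [← Complex.mul_conj', map_sum, Finset.sum_mul_sum, Finset.sum_comm]
    refine Eq.trans (Finset.sum_congr rfl fun t _ => ?_) Finset.sum_comm
    refine (Equiv.sum_comp (Equiv.addLeft t) _).symm.trans ?_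
    refine Finset.sum_congr rfl fun h _ => ?_
    rw [eval_sub, taylor_eval, AddChar.map_sub_eq_div, div_eq_mul_inv, Equiv.coe_addLeft]
    congr 1
    exact (Complex.inv_eq_conj (AddChar.norm_apply stdAddChar (P.eval t))).symm
  have h2 : ‖∑ t : ZMod q, stdAddChar (P.eval t)‖ ^ 2 ≤
      ∑ h : ZMod q, ‖∑ t : ZMod q, stdAddChar ((taylor h P - P).eval t)‖ := by
    refine le_trans ?_ (norm_sum_le _ _)
    rw [← key, Complex.norm_real]
    exact le_abs_self _
  unfold weylMean
  rw [← Finset.sum_div, div_div, div_pow, ← sq]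
  gcongr

lemma exists_weylMean_le_affine (P : (ZMod q)[X]) (u : ZMod q) :
    ∃ t : ZMod q, weylMean P ≤ weylMean ((taylor t P).comp (C u * X)) := by
  have hq := natCast_pos_of_neZero q
  by_contra! hcon
  have h1 : (∑ t : ZMod q, ∑ z : ZMod q, stdAddChar (((taylor t P).comp (C u * X)).eval z)) =
      q * ∑ t : ZMod q, stdAddChar (P.eval t) := by
    rw [Finset.sum_comm]
    have : ∀ z : ZMod q, ∑ t : ZMod q, stdAddChar (((taylor t P).comp (C u * X)).eval z) =
        ∑ t : ZMod q, stdAddChar (P.eval t) := by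
      intro z
      refine Eq.trans ?_
        (Equiv.sum_comp (Equiv.addLeft (u * z)) fun t => stdAddChar (P.eval t))
      refine Finset.sum_congr rfl fun t _ => ?_
      simp [taylor_eval]
    simp only [this, Finset.sum_const, Finset.card_univ, ZMod.card, nsmul_eq_mul]
  have h2 : ∑ t : ZMod q, weylMean ((taylor t P).comp (C u * X)) < ∑ t : ZMod q, weylMean P :=
    Finset.sum_lt_sum_of_nonempty Finset.univ_nonempty fun t _ => hcon t
  have h3 := (norm_sum_le Finset.univ
    fun t => ∑ z : ZMod q, stdAddChar (((taylor t P).comp (C u * X)).eval z))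
  rw [h1, norm_mul] at h3
  simp only [weylMean, ← Finset.sum_div] at h2
  rw [Finset.sum_const, Finset.card_univ, ZMod.card, nsmul_eq_mul, div_lt_iff₀ hq] at h2
  have : (q : ℝ) * ‖∑ t : ZMod q, stdAddChar (P.eval t)‖ / q * q =
      q * ‖∑ t : ZMod q, stdAddChar (P.eval t)‖ := by field_simp
  rw [this] at h2
  rw [Complex.norm_natCast] at h3
  linarith

lemma nonconstOrder_le_mul_affine (P : (ZMod q)[X]) {d : ℕ} (hP : P.natDegree ≤ d) (t : ZMod q)
    {u : ℕ} (hu : 0 < u) :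
    nonconstOrder P ≤ nonconstOrder ((taylor t P).comp (C (u : ZMod q) * X)) * u ^ d := by
  set R := (taylor t P).comp (C (u : ZMod q) * X)
  refine Nat.le_of_dvd (Nat.mul_pos (nonconstOrder_pos R) (pow_pos hu d)) ?_
  have h1 : nonconstOrder (taylor t P) ∣ nonconstOrder R * u ^ d := by
    rw [nonconstOrder_dvd_iff]
    intro i hi
    by_cases hid : i ≤ d
    · have h := (nonconstOrder_dvd_iff R _).1 dvd_rfl i hi
      rw [comp_C_mul_X_coeff, nsmul_eq_mul] at h
      obtain ⟨e, rfl⟩ := Nat.exists_eq_add_of_le hid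
      rw [nsmul_eq_mul]
      push_cast
      rw [pow_add]
      linear_combination (u : ZMod q) ^ e * h
    · rw [coeff_eq_zero_of_natDegree_lt (by rw [natDegree_taylor]; omega), smul_zero]
  rw [nonconstOrder_dvd_iff_exists] at h1 ⊢
  obtain ⟨c, hc⟩ := h1
  refine ⟨c, ?_⟩
  have := congrArg (taylor (-t)) hc
  rwa [map_nsmul, taylor_taylor, neg_add_cancel, taylor_zero, taylor_C] at this

end

/-- Complete exponential sums of polynomials of degree at most `d` enjoy a power saving in the
order of the nonconstant part of the polynomial. -/
def HasWeylBound (d : ℕ) : Prop :=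
  ∃ K : ℕ, 0 < K ∧ ∃ A : ℝ, 1 ≤ A ∧ ∀ (q : ℕ) [NeZero q] (P : (ZMod q)[X]),
    P.natDegree ≤ d → weylMean P ^ K * nonconstOrder P ≤ A

lemma hasWeylBound_one : HasWeylBound 1 := by
  refine ⟨1, one_pos, 1, le_rfl, fun q _ P hP => ?_⟩
  have heq := eq_X_add_C_of_natDegree_le_one hP
  by_cases ha : P.coeff 1 = 0
  · have : nonconstOrder P ∣ 1 := by
      rw [nonconstOrder_dvd_iff_exists]
      rw [ha, C_0, zero_mul, zero_add] at heq
      exact ⟨P.coeff 0, by rw [one_smul]; exact heq⟩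
    rw [Nat.dvd_one.1 this]
    simpa using weylMean_le_one P
  · have : weylMean P = 0 := by
      have hs : ∑ t : ZMod q, stdAddChar (P.eval t) =
          (∑ t : ZMod q, stdAddChar (t * P.coeff 1)) * stdAddChar (P.coeff 0) := by
        rw [Finset.sum_mul]
        refine Finset.sum_congr rfl fun t _ => ?_
        rw [← AddChar.map_add_eq_mul]
        congr 1
        refine (congrArg (eval t) heq).trans ?_
        rw [eval_add, eval_mul, eval_C, eval_C, eval_X, mul_comm]
      rw [weylMean, hs, AddChar.sum_mulShift _ (isPrimitive_stdAddChar q), if_neg ha]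
      simp
    rw [this, pow_one, zero_mul]
    exact zero_le_one

lemma HasWeylBound.succ {d : ℕ} (hd : d ≠ 0) (H : HasWeylBound d) : HasWeylBound (d + 1) := by
  obtain ⟨K, hK, A, hA, H⟩ := H
  have hA0 : 0 < A := one_pos.trans_le hA
  set B : ℝ := A ^ 3 * (2 * (d + 1)) with hB
  have hB1 : 1 ≤ B := by
    have : (1 : ℝ) ≤ A ^ 3 := one_le_pow₀ hA
    have hd0 : (0 : ℝ) ≤ d := Nat.cast_nonneg d
    nlinarith
  refine ⟨K + 6 * K * (d + 1), by omega, A * B ^ (d + 1),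
    one_le_mul_of_one_le_of_one_le hA (one_le_pow₀ hB1), fun q _ P hP => ?_⟩
  have hq := natCast_pos_of_neZero q
  set a := P.coeff (d + 1)
  set u := addOrderOf a
  have hu : 0 < u := addOrderOf_pos a
  have hS := weylMean_nonneg P
  have differenced : weylMean P ^ (6 * K) * u ≤ B := by
    set x := (d + 1) • a
    have hx : (0 : ℝ) < addOrderOf x := Nat.cast_pos.2 (addOrderOf_pos x)
    have hux : (u : ℝ) ≤ (d + 1) * addOrderOf x := by
      exact_mod_cast addOrderOf_le_mul_addOrderOf_nsmul a d.succ_pos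
    have hterm : ∀ h : ZMod q, weylMean (taylor h P - P) ^ (3 * K) ≤
        A ^ 3 * ((addOrderOf (x * h) : ℝ) ^ 3)⁻¹ := by
      intro h
      have h0 := weylMean_nonneg (taylor h P - P)
      have ho : (0 : ℝ) < addOrderOf (x * h) := Nat.cast_pos.2 (addOrderOf_pos _)
      have h1 := H q (taylor h P - P) (natDegree_taylor_sub_le P hP h)
      have h2 := addOrderOf_coeff_le_nonconstOrder (taylor h P - P) hd
      rw [coeff_taylor_sub P hP h] at h2
      have h3 : weylMean (taylor h P - P) ^ K * addOrderOf (x * h) ≤ A := by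
        refine le_trans ?_ h1
        gcongr
      rw [← div_eq_mul_inv, le_div_iff₀ (by positivity), mul_comm 3 K, pow_mul, ← mul_pow]
      gcongr
    have hmean : weylMean P ^ (6 * K) ≤ A ^ 3 * (2 / addOrderOf x) := by
      calc weylMean P ^ (6 * K) = (weylMean P ^ 2) ^ (3 * K) := by rw [← pow_mul]; ring_nf
        _ ≤ ((∑ h : ZMod q, weylMean (taylor h P - P)) / q) ^ (3 * K) := by
            gcongr; exact weylMean_sq_le P
        _ = (∑ h : ZMod q, (q : ℝ)⁻¹ * weylMean (taylor h P - P)) ^ (3 * K) := by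
            rw [← Finset.mul_sum, div_eq_inv_mul]
        _ ≤ ∑ h : ZMod q, (q : ℝ)⁻¹ * weylMean (taylor h P - P) ^ (3 * K) := by
            refine Real.pow_arith_mean_le_arith_mean_pow _ _ _ (fun _ _ => by positivity) ?_
              (fun _ _ => weylMean_nonneg _) _
            simp [hq.ne']
        _ ≤ ∑ h : ZMod q, (q : ℝ)⁻¹ * (A ^ 3 * ((addOrderOf (x * h) : ℝ) ^ 3)⁻¹) := by
            gcongr with h; exact hterm h
        _ = (q : ℝ)⁻¹ * A ^ 3 * ∑ h : ZMod q, ((addOrderOf (x * h) : ℝ) ^ 3)⁻¹ := by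
            rw [Finset.mul_sum]; simp only [mul_assoc]
        _ ≤ (q : ℝ)⁻¹ * A ^ 3 * (2 * (q / addOrderOf x)) := by
            gcongr; exact sum_inv_addOrderOf_mul_cubed_le x
        _ = _ := by field_simp
    calc weylMean P ^ (6 * K) * u ≤ A ^ 3 * (2 / addOrderOf x) * ((d + 1) * addOrderOf x) := by
          gcongr
      _ = B := by rw [hB]; field_simp
  have dilated : weylMean P ^ K * nonconstOrder P ≤ A * u ^ (d + 1) := by
    obtain ⟨t, ht⟩ := exists_weylMean_le_affine P (u : ZMod q)
    set R := (taylor t P).comp (C (u : ZMod q) * X) with hR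
    have hR0 := weylMean_nonneg R
    have hdegR : R.natDegree ≤ d := by
      rw [natDegree_le_iff_coeff_eq_zero]
      intro N hN
      rw [hR, comp_C_mul_X_coeff]
      rcases Nat.lt_or_ge (d + 1) N with h | h
      · rw [coeff_eq_zero_of_natDegree_lt (by rw [natDegree_taylor]; omega), zero_mul]
      · obtain rfl : N = d + 1 := by omega
        have h1 : (taylor t P).coeff (d + 1) = a := by
          have := natDegree_taylor_sub_le P hP t
          rw [natDegree_le_iff_coeff_eq_zero] at this
          have := this (d + 1) d.lt_succ_self
          rwa [coeff_sub, sub_eq_zero] at this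
        have h2 : (u : ZMod q) * a = 0 := by
          rw [← nsmul_eq_mul]; exact addOrderOf_nsmul_eq_zero a
        rw [h1, pow_succ, mul_comm, mul_assoc, h2, mul_zero]
    have h1 := H q R hdegR
    have h2 : (nonconstOrder P : ℝ) ≤ nonconstOrder R * (u : ℝ) ^ (d + 1) := by
      exact_mod_cast nonconstOrder_le_mul_affine P hP t hu
    calc weylMean P ^ K * nonconstOrder P
        ≤ weylMean R ^ K * (nonconstOrder R * (u : ℝ) ^ (d + 1)) := by gcongr
      _ = (weylMean R ^ K * nonconstOrder R) * (u : ℝ) ^ (d + 1) := by ring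
      _ ≤ _ := by gcongr
  calc weylMean P ^ (K + 6 * K * (d + 1)) * nonconstOrder P
      = (weylMean P ^ K * nonconstOrder P) * (weylMean P ^ (6 * K)) ^ (d + 1) := by
        rw [pow_add, pow_mul _ (6 * K)]; ring
    _ ≤ (A * u ^ (d + 1)) * (weylMean P ^ (6 * K)) ^ (d + 1) := by gcongr
    _ = A * (weylMean P ^ (6 * K) * u) ^ (d + 1) := by rw [mul_pow]; ring
    _ ≤ _ := by gcongr

lemma hasWeylBound {d : ℕ} (hd : 1 ≤ d) : HasWeylBound d := by
  induction d, hd using Nat.le_induction with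
  | base => exact hasWeylBound_one
  | succ d hd ih => exact ih.succ (by omega)

/-- The exponents along the curve `t ↦ (t ^ (N₀+1)^j)_j` separate the multi-indices in `Γ`. -/
def curveWeight {k N₀ : ℕ} (γ : Fin k → Fin (N₀ + 1)) : ℕ :=
  ∑ j : Fin k, (γ j : ℕ) * (N₀ + 1) ^ (j : ℕ)

lemma curveWeight_injective (k N₀ : ℕ) :
    Function.Injective (curveWeight : (Fin k → Fin (N₀ + 1)) → ℕ) := by
  intro γ γ' h
  exact finFunctionFinEquiv.injective (Fin.ext h)

lemma curveWeight_lt {k N₀ : ℕ} (γ : Fin k → Fin (N₀ + 1)) :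
    curveWeight γ < (N₀ + 1) ^ k :=
  (finFunctionFinEquiv γ).isLt

lemma curveWeight_ne_zero {k N₀ : ℕ} (γ : GammaSet k N₀) : curveWeight γ.1 ≠ 0 := by
  intro h
  refine γ.2 (curveWeight_injective k N₀ (h.trans ?_))
  simp [curveWeight]

section

variable {k N₀ q : ℕ}

/-- The monomial `z ^ γ` restricted to the translated curve `t ↦ y + (t ^ (N₀+1)^j)_j`. -/
def curveMonomial (y : Fin k → ZMod q) (γ : Fin k → Fin (N₀ + 1)) : (ZMod q)[X] :=
  ∏ j : Fin k, (X ^ (N₀ + 1) ^ (j : ℕ) + C (y j)) ^ (γ j : ℕ)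

/-- The polynomial `∑ γ, a γ * z ^ γ` restricted to the translated curve
`t ↦ y + (t ^ (N₀+1)^j)_j`. -/
def curvePoly (a : GammaSet k N₀ → ℕ) (y : Fin k → ZMod q) : (ZMod q)[X] :=
  ∑ γ, a γ • curveMonomial y γ.1

lemma monic_curveMonomial (y : Fin k → ZMod q) (γ : Fin k → Fin (N₀ + 1)) :
    (curveMonomial y γ).Monic :=
  monic_prod_of_monic _ _ fun _ _ => (monic_X_pow_add_C _ (by positivity)).pow _

lemma natDegree_curveMonomial [Nontrivial (ZMod q)] (y : Fin k → ZMod q)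
    (γ : Fin k → Fin (N₀ + 1)) : (curveMonomial y γ).natDegree = curveWeight γ := by
  rw [curveMonomial, natDegree_prod_of_monic _ _
    fun _ _ => (monic_X_pow_add_C _ (by positivity)).pow _]
  refine Finset.sum_congr rfl fun j _ => ?_
  rw [(monic_X_pow_add_C _ (by positivity)).natDegree_pow, natDegree_X_pow_add_C]

/-- The phase `∑ γ, a γ * z ^ γ` modulo `q`. -/
def phaseZMod (a : GammaSet k N₀ → ℕ) (z : Fin k → ZMod q) : ZMod q :=
  ∑ γ : GammaSet k N₀, a γ • ∏ j, z j ^ (γ.1 j : ℕ)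

lemma eval_curvePoly (a : GammaSet k N₀ → ℕ) (y : Fin k → ZMod q) (t : ZMod q) :
    (curvePoly a y).eval t = phaseZMod a (fun j => t ^ (N₀ + 1) ^ (j : ℕ) + y j) := by
  simp [curvePoly, phaseZMod, curveMonomial, eval_finsetSum, eval_prod]

lemma natDegree_curvePoly_le (a : GammaSet k N₀ → ℕ) (y : Fin k → ZMod q) :
    (curvePoly a y).natDegree ≤ (N₀ + 1) ^ k := by
  cases subsingleton_or_nontrivial (ZMod q)
  · rw [Subsingleton.elim (curvePoly a y) 0]; simp
  refine natDegree_sum_le_of_forall_le _ _ fun γ _ => ?_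
  refine (natDegree_smul_le _ _).trans ?_
  rw [natDegree_curveMonomial]
  exact (curveWeight_lt _).le

lemma nsmul_coeff_eq_zero_of_curvePoly [Nontrivial (ZMod q)] {a : GammaSet k N₀ → ℕ}
    {y : Fin k → ZMod q} {n : ℕ} (hn : ∀ i, i ≠ 0 → n • (curvePoly a y).coeff i = 0)
    (γ : GammaSet k N₀) : ((n * a γ : ℕ) : ZMod q) = 0 := by
  by_contra hγ
  obtain ⟨γ₀, hγ₀, hmax⟩ := Finset.exists_max_image
    (Finset.univ.filter fun γ : GammaSet k N₀ => ((n * a γ : ℕ) : ZMod q) ≠ 0)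
    (fun γ => curveWeight γ.1) ⟨γ, by simpa using hγ⟩
  simp only [Finset.mem_filter, Finset.mem_univ, true_and] at hγ₀ hmax
  apply hγ₀
  have h := hn _ (curveWeight_ne_zero γ₀)
  rw [curvePoly, finsetSum_coeff, Finset.smul_sum, Finset.sum_eq_single γ₀] at h
  · rw [coeff_smul, ← natDegree_curveMonomial y γ₀.1,
      (monic_curveMonomial y γ₀.1).coeff_natDegree] at h
    simpa [mul_comm] using h
  · intro γ' _ hne
    rw [coeff_smul]
    by_cases h0 : ((n * a γ' : ℕ) : ZMod q) = 0
    · rw [smul_smul, nsmul_eq_mul, h0, zero_mul]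
    · rw [coeff_eq_zero_of_natDegree_lt, smul_zero, smul_zero]
      rw [natDegree_curveMonomial]
      refine lt_of_le_of_ne (hmax γ' h0) fun he => hne ?_
      exact Subtype.ext (curveWeight_injective k N₀ he)
  · simp

variable [NeZero q]

lemma le_nonconstOrder_curvePoly {a : GammaSet k N₀ → ℕ}
    (ha : Nat.gcd q (Finset.univ.gcd a) = 1) (y : Fin k → ZMod q) :
    q ≤ nonconstOrder (curvePoly a y) := by
  have hpos := nonconstOrder_pos (curvePoly a y)
  rcases subsingleton_or_nontrivial (ZMod q) with hs | _
  · have : q = 1 := by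
      have := ZMod.card q
      rw [← this]
      exact le_antisymm (Fintype.card_le_one_iff_subsingleton.2 hs) Fintype.card_pos
    omega
  refine Nat.le_of_dvd hpos ?_
  refine Nat.Coprime.dvd_of_dvd_mul_right ha ?_
  have h : q ∣ Finset.univ.gcd fun γ => nonconstOrder (curvePoly a y) * a γ :=
    Finset.dvd_gcd fun γ _ => (ZMod.natCast_eq_zero_iff _ _).1 <|
      nsmul_coeff_eq_zero_of_curvePoly ((nonconstOrder_dvd_iff _ _).1 dvd_rfl) γ
  rwa [Finset.gcd_mul_left, normalize_eq] at h

lemma norm_sum_phaseZMod_le (a : GammaSet k N₀ → ℕ) {B : ℝ}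
    (hB : ∀ y : Fin k → ZMod q, weylMean (curvePoly a y) ≤ B) :
    ‖∑ z : Fin k → ZMod q, stdAddChar (phaseZMod a z)‖ ≤ q ^ k * B := by
  have hq := natCast_pos_of_neZero q
  have h1 : ∑ y : Fin k → ZMod q, ∑ t : ZMod q, stdAddChar ((curvePoly a y).eval t) =
      q * ∑ z : Fin k → ZMod q, stdAddChar (phaseZMod a z) := by
    rw [Finset.sum_comm]
    have : ∀ t : ZMod q, ∑ y : Fin k → ZMod q, stdAddChar ((curvePoly a y).eval t) =
        ∑ z : Fin k → ZMod q, stdAddChar (phaseZMod a z) := by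
      intro t
      refine Eq.trans ?_
        (Equiv.sum_comp (Equiv.addLeft fun j : Fin k => t ^ (N₀ + 1) ^ (j : ℕ))
          fun z => stdAddChar (phaseZMod a z))
      refine Finset.sum_congr rfl fun y _ => ?_
      rw [eval_curvePoly]
      rfl
    simp [this]
  have h2 : ‖∑ y : Fin k → ZMod q, ∑ t : ZMod q, stdAddChar ((curvePoly a y).eval t)‖ ≤
      ∑ y : Fin k → ZMod q, B * q := by
    refine (norm_sum_le _ _).trans (Finset.sum_le_sum fun y _ => ?_)
    rw [← div_le_iff₀ hq]
    exact hB y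
  rw [h1, norm_mul] at h2
  simp at h2
  refine le_of_mul_le_mul_left ?_ hq
  linarith

lemma expc_dotQ_div (a : GammaSet k N₀ → ℕ) (y : Fin k → ℕ) :
    expc (dotQ (fun γ => (a γ : ℝ) / q) fun j => (y j : ℝ)) =
      stdAddChar (phaseZMod (q := q) a fun j => (y j : ZMod q)) := by
  have h1 : phaseZMod (q := q) a (fun j => (y j : ZMod q)) =
      ((∑ γ : GammaSet k N₀, a γ * ∏ j, y j ^ (γ.1 j : ℕ) : ℕ) : ℤ) := by
    simp [phaseZMod]
  have h2 : dotQ (fun γ : GammaSet k N₀ => (a γ : ℝ) / q) (fun j => (y j : ℝ)) =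
      ((∑ γ : GammaSet k N₀, a γ * ∏ j, y j ^ (γ.1 j : ℕ) : ℕ) : ℝ) / q := by
    rw [dotQ]
    push_cast
    rw [Finset.sum_div]
    exact Finset.sum_congr rfl fun γ _ => by ring
  rw [h1, h2, stdAddChar_coe, expc]
  congr 1
  push_cast
  ring

lemma sum_piFinset_Icc_natCast (F : (Fin k → ZMod q) → ℂ) :
    ∑ y ∈ Fintype.piFinset (fun _ : Fin k => Finset.Icc 1 q), F (fun j => (y j : ZMod q)) =
      ∑ z, F z := by
  refine Finset.sum_bij (fun y _ j => (y j : ZMod q)) (fun _ _ => Finset.mem_univ _) ?_ ?_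
    (fun _ _ => rfl)
  · intro y hy y' hy' h
    ext j
    have h1 := Finset.mem_Icc.1 (Fintype.mem_piFinset.1 hy j)
    have h2 := Finset.mem_Icc.1 (Fintype.mem_piFinset.1 hy' j)
    have h3 := (ZMod.natCast_eq_natCast_iff _ _ _).1 (congrFun h j)
    have h4 : y j - 1 ≡ y' j - 1 [MOD q] := by
      refine Nat.ModEq.add_right_cancel' 1 ?_
      rwa [Nat.sub_add_cancel h1.1, Nat.sub_add_cancel h2.1]
    have := Nat.ModEq.eq_of_lt_of_lt h4 (by omega) (by omega)
    omega
  · intro z _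
    refine ⟨fun j => (z j - 1).val + 1, ?_, ?_⟩
    · rw [Fintype.mem_piFinset]
      intro j
      have := ZMod.val_lt (z j - 1)
      rw [Finset.mem_Icc]
      omega
    · funext j
      simp

end

/-- Gaussian sum estimate.  There are `δ > 0` and `C > 0` such that
`|G(a/q)| ≤ C q^{-δ}` for every `q ∈ ℕ` and `a ∈ A_q`. -/
theorem statement12 (k N₀ : ℕ) (hk : 1 ≤ k) (hN₀ : 1 ≤ N₀) :
    ∃ δ > (0:ℝ), ∃ C > (0:ℝ), ∀ q : ℕ, 1 ≤ q → ∀ a ∈ AqG k N₀ q,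
      ‖gaussSumQ k N₀ q a‖ ≤ C * (q : ℝ) ^ (-δ) := by
  obtain ⟨K, hK, A, hA, H⟩ := hasWeylBound (d := (N₀ + 1) ^ k) (Nat.one_le_pow _ _ (by omega))
  have hA0 : 0 < A := one_pos.trans_le hA
  refine ⟨(K : ℝ)⁻¹, by positivity, A ^ (K : ℝ)⁻¹, by positivity, fun q hq a ha => ?_⟩
  have : NeZero q := ⟨by omega⟩
  have hq0 := natCast_pos_of_neZero q
  have hgcd := (Finset.mem_filter.1 ha).2
  have hB : ∀ y : Fin k → ZMod q,
      weylMean (curvePoly a y) ≤ A ^ (K : ℝ)⁻¹ * (q : ℝ) ^ (-(K : ℝ)⁻¹) := by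
    intro y
    have h0 := weylMean_nonneg (curvePoly a y)
    have h1 : weylMean (curvePoly a y) ^ K ≤ A / q := by
      rw [le_div_iff₀ hq0]
      refine le_trans ?_ (H q _ (natDegree_curvePoly_le a y))
      gcongr
      exact le_nonconstOrder_curvePoly hgcd y
    calc weylMean (curvePoly a y) = (weylMean (curvePoly a y) ^ K) ^ (K : ℝ)⁻¹ :=
          (Real.pow_rpow_inv_natCast h0 hK.ne').symm
      _ ≤ (A / q) ^ (K : ℝ)⁻¹ := by gcongr
      _ = _ := by rw [Real.div_rpow hA0.le hq0.le, Real.rpow_neg hq0.le, div_eq_mul_inv]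
  rw [gaussSumQ]
  simp only [expc_dotQ_div (q := q)]
  rw [sum_piFinset_Icc_natCast (fun z => stdAddChar (phaseZMod a z)), norm_mul, norm_inv, norm_pow,
    Complex.norm_natCast, inv_mul_le_iff₀ (by positivity)]
  exact norm_sum_phaseZMod_le a hB

end
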